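/- Let A and B be finite nonempty types, M : Matrix A B ℝ, and for x : A → ℝ, y : B → ℝ write u x y = ∑ a, ∑ b, x a * M a b * y b. Let R ≥ 0 and c ∈ ℝ be such that u x y ∈ [c, c + R] for all x ∈ stdSimplex ℝ A and y ∈ stdSimplex ℝ B. Fix an integer t ≥ 1, strategies ȳ, y' ∈ stdSimplex ℝ B, and let μ = (t/(t+2)) • ȳ + (2/(t+2)) • y'. If x* ∈ stdSimplex ℝ A satisfies u x μ ≤ u x* μ for all x ∈ stdSimplex ℝ A, then x* is a (2R/t)-best response to ȳ: u x ȳ ≤ u x* ȳ + 2*R/t for all x ∈ stdSimplex ℝ A. In particular, the best-response gap bound 2R/t tends to 0 as t → ∞. -/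

import Mathlib

open scoped BigOperators

/-- In FLOP, an exact best response to the optimistic mixture
`(t/(t+2))·ȳ + (2/(t+2))·y'` is a `(2R/t)`-best response to the average
strategy `ȳ`, and this gap tends to `0` as `t → ∞`. -/
theorem flop_iterate_is_asymptotic_best_response
    {A B : Type*} [Fintype A] [Fintype B] [Nonempty A] [Nonempty B]
    (M : Matrix A B ℝ)
    (u : (A → ℝ) → (B → ℝ) → ℝ)
    (hu : ∀ x y, u x y = ∑ a, ∑ b, x a * M a b * y b)
    (R c : ℝ) (hR : 0 ≤ R)
    (hrange : ∀ x ∈ stdSimplex ℝ A, ∀ y ∈ stdSimplex ℝ B,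
      u x y ∈ Set.Icc c (c + R))
    (t : ℕ) (ht : 1 ≤ t)
    (ybar y' : B → ℝ) (hybar : ybar ∈ stdSimplex ℝ B) (hy' : y' ∈ stdSimplex ℝ B)
    (μ : B → ℝ) (hμ : μ = ((t : ℝ) / ((t : ℝ) + 2)) • ybar + (2 / ((t : ℝ) + 2)) • y')
    (xstar : A → ℝ) (hxstar : xstar ∈ stdSimplex ℝ A)
    (hbr : ∀ x ∈ stdSimplex ℝ A, u x μ ≤ u xstar μ) :
    (∀ x ∈ stdSimplex ℝ A, u x ybar ≤ u xstar ybar + 2 * R / (t : ℝ)) ∧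
    Filter.Tendsto (fun n : ℕ => 2 * R / (n : ℝ)) Filter.atTop (nhds 0) := by
  refine ⟨fun x hx => ?_, tendsto_const_div_atTop_nhds_zero_nat (2 * R)⟩
  have ht0 : (0 : ℝ) < t := by exact_mod_cast ht
  have hmix : ∀ z, u z μ = (t / (t + 2)) * u z ybar + (2 / (t + 2)) * u z y' := by
    intro z
    simp only [hu, hμ, Pi.add_apply, Pi.smul_apply, smul_eq_mul, Finset.mul_sum,
      ← Finset.sum_add_distrib]
    exact Finset.sum_congr rfl fun a _ => Finset.sum_congr rfl fun b _ => by ring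
  have hscaled : ∀ z, (t + 2) * u z μ = t * u z ybar + 2 * u z y' := by
    intro z
    rw [hmix]
    field_simp
  have hopt := mul_le_mul_of_nonneg_left (hbr x hx) (by positivity : (0 : ℝ) ≤ t + 2)
  rw [hscaled, hscaled] at hopt
  have hlow := (hrange x hx y' hy').1
  have hhigh := (hrange xstar hxstar y' hy').2
  rw [← sub_le_iff_le_add', le_div_iff₀ ht0]
  linarith
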